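/- arXiv:2506.09667 — 4 statements merged into one kernel-verified Lean document; each statement's English description precedes it below -/
import Mathlib

section
/- Let G8 be the simple graph on vertex set Fin 8 whose edges are exactly {0,1}, {0,2}, {0,3}, {1,4}, {1,5}, {2,3}, {2,6}, {3,7}, {4,5}, {4,7}, {5,6}, {6,7}, and let G8'' be the graph obtained from G8 by adding the edge {3,6}. Then G8'' is hamiltonian-connected, but there is no path in G8'' between the vertices 2 and 3 of length 4. -/
/-- A graph is hamiltonian-connected if any two distinct vertices are joined by a
hamiltonian path, i.e. a path visiting every vertex. -/
def SimpleGraph.HamiltonianConnected {V : Type*} (G : SimpleGraph V) : Prop :=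
  ∀ u v : V, u ≠ v → ∃ p : G.Walk u v, p.IsPath ∧ ∀ w : V, w ∈ p.support

/-- The smallest counterexample to the Faudree–Schelp conjecture. -/
def G8 : SimpleGraph (Fin 8) :=
  SimpleGraph.fromEdgeSet
    {s(0,1), s(0,2), s(0,3), s(1,4), s(1,5), s(2,3), s(2,6), s(3,7),
     s(4,5), s(4,7), s(5,6), s(6,7)}

/-- `G8` with the edge `{3,6}` added. -/
def G8'' : SimpleGraph (Fin 8) :=
  G8 ⊔ SimpleGraph.fromEdgeSet {s(3,6)}

namespace SimpleGraph

variable {V : Type*} {G : SimpleGraph V}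

theorem exists_hamiltonian_path_of_isChain {u v : V} (l : List V) (hne : l ≠ [])
    (hchain : l.IsChain G.Adj) (hnodup : l.Nodup) (hu : l.head hne = u) (hv : l.getLast hne = v)
    (hmem : ∀ w, w ∈ l) : ∃ p : G.Walk u v, p.IsPath ∧ ∀ w : V, w ∈ p.support := by
  subst hu hv
  refine ⟨.ofSupport l hne hchain, ?_, ?_⟩
  · rwa [Walk.isPath_def, Walk.support_ofSupport]
  · rwa [Walk.support_ofSupport]

theorem Walk.IsPath.exists_of_length_eq_four {u v : V} {p : G.Walk u v} (hp : p.IsPath)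
    (h : p.length = 4) :
    ∃ a b c, G.Adj u a ∧ G.Adj a b ∧ G.Adj b c ∧ G.Adj c v ∧ [u, a, b, c, v].Nodup := by
  rcases p with _ | ⟨h₁, _ | ⟨h₂, _ | ⟨h₃, _ | ⟨h₄, _ | ⟨h₅, p⟩⟩⟩⟩⟩
  all_goals simp only [length_nil, length_cons] at h
  case cons.cons.cons.cons.nil =>
    exact ⟨_, _, _, h₁, h₂, h₃, h₄, by simpa only [support_cons, support_nil] using hp.support_nodup⟩
  all_goals omega

theorem hamiltonianConnected_of_lt [LinearOrder V]
    (h : ∀ u v : V, u < v → ∃ p : G.Walk u v, p.IsPath ∧ ∀ w : V, w ∈ p.support) :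
    G.HamiltonianConnected := by
  intro u v huv
  rcases huv.lt_or_gt with huv | hvu
  · exact h u v huv
  · obtain ⟨p, hp, hmem⟩ := h v u hvu
    exact ⟨p.reverse, hp.reverse, by simpa using hmem⟩

end SimpleGraph

instance : DecidableRel (G8'').Adj := fun u v =>
  decidable_of_iff
    (s(u, v) ∈ [s(0,1), s(0,2), s(0,3), s(1,4), s(1,5), s(2,3), s(2,6), s(3,7),
      s(4,5), s(4,7), s(5,6), s(6,7), s(3,6)]) <| by
    revert u v
    simp only [G8'', G8, SimpleGraph.sup_adj, SimpleGraph.fromEdgeSet_adj, Set.mem_insert_iff,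
      Set.mem_singleton_iff]
    decide

/-- A hamiltonian path of `G8''` between each pair of distinct vertices, up to reversal. -/
def hamiltonianPathsG8'' : List (List (Fin 8)) :=
  [[0,2,3,6,7,4,5,1], [0,1,4,5,6,7,3,2], [0,1,5,4,7,6,2,3], [0,1,5,6,2,3,7,4],
   [0,1,4,7,3,2,6,5], [0,1,5,4,7,3,2,6], [0,1,4,5,6,2,3,7], [1,0,3,7,4,5,6,2],
   [1,0,2,6,5,4,7,3], [1,0,2,3,7,6,5,4], [1,0,2,3,6,7,4,5], [1,0,2,3,7,4,5,6],
   [1,0,2,3,6,5,4,7], [2,0,1,4,5,6,7,3], [2,0,1,5,6,3,7,4], [2,0,1,4,7,3,6,5],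
   [2,0,1,5,4,7,3,6], [2,0,1,4,5,6,3,7], [3,2,0,1,5,6,7,4], [3,0,2,6,7,4,1,5],
   [3,2,0,1,5,4,7,6], [3,0,2,6,5,1,4,7], [4,1,0,2,3,7,6,5], [4,5,1,0,2,3,7,6],
   [4,1,5,6,2,0,3,7], [5,1,4,7,3,0,2,6], [5,4,1,0,2,3,6,7], [6,2,3,0,1,5,4,7]]

set_option maxRecDepth 10000 in
theorem hamiltonianPathsG8''_isHamiltonian :
    ∀ l ∈ hamiltonianPathsG8'', l.IsChain (G8'').Adj ∧ l.Nodup ∧ ∀ w, w ∈ l := by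
  decide

set_option maxRecDepth 10000 in
theorem exists_mem_hamiltonianPathsG8'' :
    ∀ u v : Fin 8, u < v → ∃ l ∈ hamiltonianPathsG8'', ∃ hne : l ≠ [],
      l.head hne = u ∧ l.getLast hne = v := by
  decide

set_option maxRecDepth 10000 in
theorem G8''_hamiltonianConnected_but_no_path_of_length_four :
    (G8'').HamiltonianConnected ∧
      ¬ ∃ p : (G8'').Walk 2 3, p.IsPath ∧ p.length = 4 := by
  refine ⟨SimpleGraph.hamiltonianConnected_of_lt fun u v huv => ?_, fun ⟨p, hp, hlen⟩ => ?_⟩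
  · obtain ⟨l, hl, hne, hu, hv⟩ := exists_mem_hamiltonianPathsG8'' u v huv
    obtain ⟨hchain, hnodup, hmem⟩ := hamiltonianPathsG8''_isHamiltonian l hl
    exact SimpleGraph.exists_hamiltonian_path_of_isChain l hne hchain hnodup hu hv hmem
  · have h := hp.exists_of_length_eq_four hlen
    revert h
    decide
end

section
/- Let H0 be the simple graph on vertex set Fin 16 whose edges are exactly {0,1}, {0,2}, {0,6}, {1,3}, {1,4}, {2,3}, {2,9}, {3,12}, {4,5}, {4,7}, {5,6}, {5,7}, {6,8}, {7,8}, {8,15}, {9,10}, {9,15}, {10,11}, {10,13}, {11,12}, {11,13}, {12,14}, {13,14}, {14,15}. Then H0 is hamiltonian-connected. -/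
/-- The cubic planar 16-vertex counterexample `H₀` from the paper. -/
def H0 : SimpleGraph (Fin 16) :=
  SimpleGraph.fromEdgeSet
    {s(0,1), s(0,2), s(0,6), s(1,3), s(1,4), s(2,3), s(2,9), s(3,12),
     s(4,5), s(4,7), s(5,6), s(5,7), s(6,8), s(7,8), s(8,15), s(9,10),
     s(9,15), s(10,11), s(10,13), s(11,12), s(11,13), s(12,14), s(13,14),
     s(14,15)}

/-- Depth-first search for a path with `n + 1` edges from `u` to `v` whose interior vertices
avoid the set with bitmask `S`, in the graph with neighbour lists `nbrs`. -/
def searchPath {k : ℕ} (nbrs : Fin k → List (Fin k)) (v : Fin k) :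
    ℕ → ℕ → Fin k → Bool
  | 0, _, u => decide (v ∈ nbrs u)
  | n + 1, S, u =>
      (nbrs u).any fun w => !S.testBit w && searchPath nbrs v n (S ||| 2 ^ w.val) w

theorem exists_isPath_of_searchPath {k : ℕ} {G : SimpleGraph (Fin k)}
    {nbrs : Fin k → List (Fin k)} (hadj : ∀ u, ∀ w ∈ nbrs u, G.Adj u w) {v : Fin k} (n : ℕ) :
    ∀ (S : ℕ) (u : Fin k), S.testBit u → S.testBit v → u ≠ v → searchPath nbrs v n S u = true →
      ∃ p : G.Walk u v, p.IsPath ∧ p.length = n + 1 ∧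
        ∀ w ∈ p.support, S.testBit w → w = u ∨ w = v := by
  induction n with
  | zero =>
    intro S u _ _ huv h
    have huv' : G.Adj u v := hadj u v (by simpa [searchPath] using h)
    exact ⟨.cons huv' .nil, by simp [huv], rfl, by simp +contextual⟩
  | succ n ih =>
    intro S u hu hv huv h
    simp only [searchPath, List.any_eq_true, Bool.and_eq_true, Bool.not_eq_true'] at h
    obtain ⟨w, hw, hwS, hs⟩ := h
    obtain ⟨p, hp, hlen, havoid⟩ := ih (S ||| 2 ^ w.val) w
      (by simp) (by simp [hv]) (fun hwv => by simp_all) hs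
    have hS : ∀ x ∈ p.support, S.testBit x → x = v := fun x hx hxS =>
      (havoid x hx (by simp [hxS])).resolve_left fun hxw => by simp_all
    refine ⟨.cons (hadj u w hw) p, hp.cons fun hup => huv (hS u hup hu), by simp [hlen], ?_⟩
    intro x hx hxS
    rw [SimpleGraph.Walk.support_cons, List.mem_cons] at hx
    exact hx.imp_right fun hxp => hS x hxp hxS

theorem SimpleGraph.Walk.IsPath.mem_support_of_length_add_one_eq_card {V : Type*} [Fintype V]
    {G : SimpleGraph V} {u v : V} {p : G.Walk u v} (hp : p.IsPath)
    (hlen : p.length + 1 = Fintype.card V) (w : V) : w ∈ p.support := by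
  classical
  have hcard : p.support.toFinset.card = Fintype.card V := by
    rw [List.toFinset_card_of_nodup hp.support_nodup, p.length_support, hlen]
  rw [← List.mem_toFinset, (Finset.card_eq_iff_eq_univ _).1 hcard]
  exact Finset.mem_univ w

/-- The neighbour lists of `H0`, ordered so that `searchPath` backtracks little. -/
def H0Nbrs : Fin 16 → List (Fin 16) :=
  ![[2, 6, 1], [3, 4, 0], [0, 9, 3], [1, 12, 2], [1, 5, 7], [7, 4, 6], [0, 8, 5], [5, 4, 8],
    [15, 6, 7], [15, 10, 2], [11, 13, 9], [13, 10, 12], [11, 3, 14], [11, 10, 14],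
    [15, 12, 13], [9, 8, 14]]

theorem H0_adj_of_mem_H0Nbrs : ∀ u, ∀ w ∈ H0Nbrs u, H0.Adj u w := by
  simp only [H0, SimpleGraph.fromEdgeSet_adj, Set.mem_insert_iff, Set.mem_singleton_iff]
  decide +kernel

theorem searchPath_H0Nbrs :
    ∀ u v : Fin 16, u < v → searchPath H0Nbrs v 14 (2 ^ u.val ||| 2 ^ v.val) u = true := by
  decide +kernel

theorem H0_hamiltonianConnected : H0.HamiltonianConnected := by
  intro u v huv
  wlog hlt : u < v generalizing u v
  · obtain ⟨p, hp, hmem⟩ := this v u huv.symm (huv.lt_or_gt.resolve_left hlt)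
    exact ⟨p.reverse, hp.reverse, fun w => by simpa using hmem w⟩
  obtain ⟨p, hp, hlen, -⟩ := exists_isPath_of_searchPath H0_adj_of_mem_H0Nbrs 14
    (2 ^ u.val ||| 2 ^ v.val) u (by simp) (by simp) huv (searchPath_H0Nbrs u v hlt)
  exact ⟨p, hp, hp.mem_support_of_length_add_one_eq_card (by simp [hlen])⟩
end

section
/- Let H0 be the simple graph on vertex set Fin 16 whose edges are exactly {0,1}, {0,2}, {0,6}, {1,3}, {1,4}, {2,3}, {2,9}, {3,12}, {4,5}, {4,7}, {5,6}, {5,7}, {6,8}, {7,8}, {8,15}, {9,10}, {9,15}, {10,11}, {10,13}, {11,12}, {11,13}, {12,14}, {13,14}, {14,15}. Then there is no path in H0 between the vertices 10 and 13 whose length is 3, 5, 7, or 9. -/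
/-- Depth-first search for a path of length `n` from `u` to `v` avoiding the vertices in `s`,
where `N w` lists the neighbours of `w`. -/
def pathSearch {V : Type*} [DecidableEq V] (N : V → List V) (v : V) : ℕ → List V → V → Bool
  | 0, _, u => decide (u = v)
  | n + 1, s, u => (N u).any fun w => !(u :: s).elem w && pathSearch N v n (u :: s) w

/-- The search finds every path. -/
theorem pathSearch_of_isPath {V : Type*} [DecidableEq V] {G : SimpleGraph V} {N : V → List V}
    (hN : ∀ u w, G.Adj u w → w ∈ N u) {u v : V} (p : G.Walk u v) (hp : p.IsPath) (s : List V)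
    (hs : ∀ w ∈ p.support, w ∉ s) : pathSearch N v p.length s u = true := by
  induction p generalizing s with
  | nil => simp [pathSearch]
  | @cons u w v h p ih =>
    rw [SimpleGraph.Walk.cons_isPath_iff] at hp
    have hs' : ∀ x ∈ p.support, x ∉ u :: s := by
      intro x hx hxs
      rcases List.mem_cons.1 hxs with rfl | hxs
      · exact hp.2 hx
      · exact hs x (by simp [hx]) hxs
    rw [SimpleGraph.Walk.length_cons, pathSearch, List.any_eq_true]
    refine ⟨w, hN u w h, ?_⟩
    rw [ih hp.1 _ hs', Bool.and_true, Bool.not_eq_true', List.elem_eq_mem, decide_eq_false_iff_not]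
    exact hs' w p.start_mem_support

/-- The adjacency lists of `H0`. -/
def H0Neighbors : Fin 16 → List (Fin 16) :=
  ![[1, 2, 6], [0, 3, 4], [0, 3, 9], [1, 2, 12], [1, 5, 7], [4, 6, 7], [0, 5, 8], [4, 5, 8],
    [6, 7, 15], [2, 10, 15], [9, 11, 13], [10, 12, 13], [3, 11, 14], [10, 11, 14], [12, 13, 15],
    [8, 9, 14]]

theorem mem_H0Neighbors_of_adj (u w : Fin 16) (h : H0.Adj u w) : w ∈ H0Neighbors u := by
  simp only [H0, SimpleGraph.fromEdgeSet_adj, Set.mem_insert_iff, Set.mem_singleton_iff,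
    Sym2.eq_iff] at h
  rcases h.1 with h | h | h | h | h | h | h | h | h | h | h | h | h | h | h | h | h | h | h | h |
    h | h | h | h <;> rcases h with ⟨rfl, rfl⟩ | ⟨rfl, rfl⟩ <;> decide

theorem H0_no_odd_path_between_10_and_13 :
    ¬ ∃ p : H0.Walk 10 13, p.IsPath ∧
      (p.length = 3 ∨ p.length = 5 ∨ p.length = 7 ∨ p.length = 9) := by
  rintro ⟨p, hp, hl⟩
  have h := pathSearch_of_isPath mem_H0Neighbors_of_adj p hp [] (by simp)
  have no_path : ∀ n ∈ [3, 5, 7, 9], pathSearch H0Neighbors 13 n [] 10 = false := by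
    decide +kernel
  rw [no_path p.length (by simpa using hl)] at h
  exact Bool.false_ne_true h
end

section
/- For every natural number k there exists a 3-regular hamiltonian-connected simple graph G on 16+6k vertices containing two adjacent vertices u and v such that there is no u–v path in G whose length is an odd number ℓ with 3 ≤ ℓ ≤ 9+4k. -/
/-- The edges `a < b` of the strip: three rails `n, n + 3, n + 6, …`, with rungs joining them in a
pattern of period `6`, and an initial triangle `0, 1, 2`. -/
def StripEdge (a b : ℕ) : Prop :=
  b = a + 3 ∨ (a % 6 = 3 ∧ b = a + 2) ∨ (a % 6 = 4 ∧ b = a + 2) ∨ (a % 6 = 1 ∧ b = a + 1) ∨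
    (a = 0 ∧ (b = 1 ∨ b = 2))

instance : DecidableRel StripEdge := fun _ _ => by unfold StripEdge; infer_instance

theorem StripEdge.shift {a b : ℕ} (m : ℕ) (ha : 3 ≤ a) (h : StripEdge a b) :
    StripEdge (6 * m + a) (6 * m + b) := by
  unfold StripEdge at *
  simp only [Nat.mul_add_mod]
  rcases h with h | h | h | h | h <;> omega

/-- Adjacency in the strip. -/
def StripAdj (a b : ℕ) : Prop := StripEdge a b ∨ StripEdge b a

instance : DecidableRel StripAdj := fun _ _ => by unfold StripAdj; infer_instance

theorem StripAdj.symm {a b : ℕ} (h : StripAdj a b) : StripAdj b a := Or.symm h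

theorem stripAdj_add_three (a : ℕ) : StripAdj a (a + 3) := Or.inl (Or.inl rfl)

theorem StripAdj.shift {a b : ℕ} (m : ℕ) (ha : 3 ≤ a) (hb : 3 ≤ b) (h : StripAdj a b) :
    StripAdj (6 * m + a) (6 * m + b) :=
  h.imp (fun h => h.shift m ha) fun h => h.shift m hb

/-- `Joins R x y l` means that `l` lists the successive vertices of a walk from `x` to `y`
in the relation `R`. -/
def Joins {α : Type*} (R : α → α → Prop) (x y : α) (l : List α) : Prop :=
  l.IsChain R ∧ l.head? = some x ∧ l.getLast? = some y

instance {α : Type*} [DecidableEq α] (R : α → α → Prop) [DecidableRel R] (x y : α) (l : List α) :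
    Decidable (Joins R x y l) := by unfold Joins; infer_instance

namespace Joins

variable {α : Type*} {R S : α → α → Prop} {x y z w : α} {l l' : List α}

theorem singleton (x : α) : Joins R x x [x] := by simp [Joins]

theorem append (h : Joins R x y l) (h' : Joins R z w l') (hyz : R y z) :
    Joins R x w (l ++ l') := by
  obtain ⟨h1, h2, h3⟩ := h
  obtain ⟨h1', h2', h3'⟩ := h'
  refine ⟨List.isChain_append.2 ⟨h1, h1', ?_⟩, ?_, ?_⟩
  · simp [h3, h2', hyz]
  · simp [h2]
  · simp [h3']

theorem reverse (hR : ∀ a b, R a b → R b a) (h : Joins R x y l) : Joins R y x l.reverse := by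
  obtain ⟨h1, h2, h3⟩ := h
  exact ⟨List.isChain_reverse.2 (h1.imp hR), by simpa using h3, by simpa using h2⟩

theorem mono (hRS : ∀ a b, R a b → S a b) (h : Joins R x y l) :
    Joins S x y l :=
  ⟨h.1.imp hRS, h.2⟩

theorem shift {x y : ℕ} {l : List ℕ} (m : ℕ) (hl : ∀ a ∈ l, 3 ≤ a) (h : Joins StripAdj x y l) :
    Joins StripAdj (6 * m + x) (6 * m + y) (l.map (6 * m + ·)) := by
  obtain ⟨h1, h2, h3⟩ := h
  refine ⟨?_, by simp [h2], by simp [h3]⟩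
  rw [List.isChain_map]
  exact h1.imp_of_mem_imp fun a b ha hb hab => hab.shift m (hl a ha) (hl b hb)

end Joins

/-- The block of six vertices by which the strip grows. -/
abbrev block : List ℕ := [3, 4, 5, 6, 7, 8]

theorem three_le_of_append_perm_block {s t : List ℕ} (h : (s ++ t).Perm block) :
    (∀ a ∈ s, 3 ≤ a) ∧ ∀ a ∈ t, 3 ≤ a := by
  have key : ∀ a ∈ s ++ t, 3 ≤ a := fun a ha => by
    have := h.mem_iff.1 ha
    simp at this
    omega
  exact ⟨fun a ha => key a (List.mem_append_left _ ha),
    fun a ha => key a (List.mem_append_right _ ha)⟩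

theorem range_add_block (m : ℕ) :
    List.range (6 * (m + 1) + 3) = List.range (6 * m + 3) ++ block.map (6 * m + ·) := by
  rw [show 6 * (m + 1) + 3 = 6 * m + 3 + 6 by ring, List.range_add]
  rfl

/-- Glueing spanning lists of the strip with `m` blocks and of the next block. -/
theorem perm_range_of_perm_block {m : ℕ} {l s t : List ℕ} (hl : l.Perm (List.range (6 * m + 3)))
    (hs : s.Perm block) (ht : t.Perm (l ++ s.map (6 * m + ·))) :
    t.Perm (List.range (6 * (m + 1) + 3)) := by
  rw [range_add_block]
  exact ht.trans (hl.append (hs.map _))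

/-- Spanning paths and spanning pairs of disjoint paths in the strip with `m` blocks, ending in its
three last vertices. -/
structure SpanningPaths (m : ℕ) : Prop where
  through : ∀ i j : Fin 3, i ≠ j → ∃ l, Joins StripAdj (6 * m + i) (6 * m + j) l ∧
    l.Perm (List.range (6 * m + 3))
  reach : ∀ x < 6 * m + 3, ∀ e : Fin 3, ∃ i ≠ e, ∃ l, Joins StripAdj x (6 * m + i) l ∧
    l.Perm (List.range (6 * m + 3))
  split : ∀ x < 6 * m + 3, ∀ y < 6 * m + 3, x ≠ y → ∃ i j : Fin 3, i ≠ j ∧ ∃ l₁ l₂,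
    Joins StripAdj x (6 * m + i) l₁ ∧ Joins StripAdj y (6 * m + j) l₂ ∧
      (l₁ ++ l₂).Perm (List.range (6 * m + 3))

theorem spanningPaths_zero : SpanningPaths 0 where
  through := by
    have h : ∀ i j : Fin 3, i ≠ j → Joins StripAdj (6 * 0 + i) (6 * 0 + j) [i, 3 - i - j, j] ∧
      [(i : ℕ), 3 - i - j, j].Perm (List.range (6 * 0 + 3)) := by decide
    exact fun i j hij => ⟨_, h i j hij⟩
  reach := by
    have h : ∀ x < 6 * 0 + 3, ∀ e : Fin 3, ∃ i ≠ e, Joins StripAdj x (6 * 0 + i) [x, 3 - x - i, i] ∧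
      [x, 3 - x - i, i].Perm (List.range (6 * 0 + 3)) := by decide
    exact fun x hx e => (h x hx e).imp fun i hi => ⟨hi.1, _, hi.2⟩
  split := by
    have h : ∀ x y : Fin 3, x ≠ y → ∃ i j : Fin 3, i ≠ j ∧
      Joins StripAdj x (6 * 0 + i) [x, 3 - x - y] ∧ Joins StripAdj y (6 * 0 + j) [y] ∧
      ([(x : ℕ), 3 - x - y] ++ [(y : ℕ)]).Perm (List.range (6 * 0 + 3)) := by decide
    exact fun x hx y hy hxy => by
      obtain ⟨i, j, hij, h⟩ := h ⟨x, hx⟩ ⟨y, hy⟩ (by simpa using hxy)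
      exact ⟨i, j, hij, _, _, h⟩

/-- `Detour x y s₁ s₂ s` means that `s₁` starts at `x` and `s₂` ends at `y`, that both can be linked
through the part of the strip before the block, and that together with `s` they span the block. -/
def Detour (x y : ℕ) (s₁ s₂ s : List ℕ) : Prop :=
  (s₁ ++ s₂ ++ s).Perm block ∧
    ∃ i j : Fin 3, i ≠ j ∧ Joins StripAdj x (3 + i) s₁ ∧ Joins StripAdj (3 + j) y s₂

instance (x y : ℕ) (s₁ s₂ s : List ℕ) : Decidable (Detour x y s₁ s₂ s) := by
  unfold Detour; infer_instance

theorem SpanningPaths.exists_of_detour {m x y : ℕ} {s₁ s₂ s : List ℕ} (hm : SpanningPaths m)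
    (h : Detour x y s₁ s₂ s) : ∃ l, Joins StripAdj (6 * m + x) (6 * m + y) l ∧
      (l ++ s.map (6 * m + ·)).Perm (List.range (6 * (m + 1) + 3)) := by
  obtain ⟨hp, i, j, hij, h₁, h₂⟩ := h
  obtain ⟨l, hl, hlp⟩ := hm.through i j hij
  have h3 := three_le_of_append_perm_block hp
  have h3' := three_le_of_append_perm_block (List.append_assoc s₁ s₂ s ▸ hp)
  refine ⟨s₁.map (6 * m + ·) ++ l ++ s₂.map (6 * m + ·),
    ((h₁.shift m h3'.1).append hl ?_).append
      (h₂.shift m fun a ha => h3.1 a (List.mem_append_right _ ha)) ?_,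
    perm_range_of_perm_block hlp hp ?_⟩
  · convert (stripAdj_add_three (6 * m + i)).symm using 1
    ring
  · convert stripAdj_add_three (6 * m + j) using 1
    ring
  · rw [List.perm_iff_count]
    intro a
    simp only [List.count_append, List.map_append]
    ring

/-- Detours spanning the block. -/
def fullDetours : List (List ℕ × List ℕ) :=
  [([3], [5, 8, 7, 4, 6]), ([3, 6, 4], [5, 8, 7]), ([4, 6, 3], [5, 8, 7]), ([4, 7, 8, 5], [3, 6]),
    ([5], [3, 6, 4, 7, 8]), ([5, 8, 7, 4], [3, 6]), ([6, 3, 5], [4, 7, 8]), ([6, 4], [3, 5, 8, 7]),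
    ([7, 4, 6, 3], [5, 8]), ([7, 8, 5, 3], [4, 6]), ([8, 5], [3, 6, 4, 7]), ([8, 7, 4], [5, 3, 6])]

/-- Detours spanning the block together with one further path. -/
def partialDetours : List (List ℕ × List ℕ × List ℕ) :=
  [([3], [5, 8, 7], [4, 6]), ([3], [4, 6], [5, 8, 7]), ([3], [5, 8], [6, 4, 7]),
    ([3, 5], [4, 6], [7, 8]), ([3, 5], [4, 6], [8, 7]), ([4], [3, 6], [5, 8, 7]),
    ([4], [3, 5, 8, 7], [6]), ([4], [5, 3, 6], [7, 8]), ([4], [5, 3, 6], [8, 7]),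
    ([5, 3], [4, 7, 8], [6]), ([5, 3], [4, 6], [7, 8]), ([5, 3], [4, 6], [8, 7]),
    ([6, 4], [3, 5, 8], [7]), ([6, 3, 5], [4, 7], [8]), ([7, 4], [5, 3, 6], [8])]

/-- Partitions of the block into two paths, the first one between the two sides of the block. -/
def blockSplits : List (List ℕ × List ℕ) :=
  [([3, 5, 8], [6, 4, 7]), ([3, 5, 8], [7, 4, 6]), ([3, 5, 8, 7], [4, 6]), ([3, 6, 4, 7], [5, 8]),
    ([4, 6], [3, 5, 8, 7]), ([4, 6, 3, 5, 8], [7]), ([4, 7], [6, 3, 5, 8]), ([4, 7], [8, 5, 3, 6]),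
    ([4, 7, 8], [5, 3, 6]), ([5, 3, 6], [4, 7, 8]), ([5, 3, 6, 4, 7], [8]), ([5, 8], [3, 6, 4, 7])]

/-- Spanning paths of the block along which a path can be prolonged. -/
def blockPaths : List (List ℕ) := [[3, 5, 8, 7, 4, 6], [4, 6, 3, 5, 8, 7], [5, 3, 6, 4, 7, 8]]

theorem exists_through_detour : ∀ i j : Fin 3, i ≠ j →
    ∃ t ∈ fullDetours, Detour (6 + i) (6 + j) t.1 t.2 [] := by
  decide +kernel

theorem exists_reach_detour : ∀ x ∈ block, ∀ e : Fin 3, ∃ i ≠ e,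
    ∃ t ∈ fullDetours, Detour x (6 + i) t.1 t.2 [] := by
  decide +kernel

theorem exists_split_detour : ∀ x ∈ block, ∀ y ∈ block, x < y → ∃ i j : Fin 3, i ≠ j ∧
    ∃ t ∈ partialDetours, Detour x (6 + i) t.1 t.2.1 t.2.2 ∧ Joins StripAdj y (6 + j) t.2.2 := by
  decide +kernel

theorem exists_blockPath : ∀ i : Fin 3, ∃ s ∈ blockPaths,
    Joins StripAdj (3 + i) (6 + i) s ∧ s.Perm block := by
  decide +kernel

theorem exists_blockSplit_left : ∀ i j : Fin 3, i ≠ j → ∃ i' j' : Fin 3, i' ≠ j' ∧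
    ∃ t ∈ blockSplits, Joins StripAdj (3 + i) (6 + i') t.1 ∧ Joins StripAdj (3 + j) (6 + j') t.2 ∧
      (t.1 ++ t.2).Perm block := by
  decide +kernel

theorem exists_blockSplit_mixed : ∀ y ∈ block, ∃ e : Fin 3, ∀ i ≠ e, ∃ i' j' : Fin 3, i' ≠ j' ∧
    ∃ t ∈ blockSplits, Joins StripAdj (3 + i) (6 + i') t.1 ∧ Joins StripAdj y (6 + j') t.2 ∧
      (t.1 ++ t.2).Perm block := by
  decide +kernel

theorem Joins.append_block {m x : ℕ} {i : Fin 3} {y : ℕ} {l s : List ℕ}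
    (h : Joins StripAdj x (6 * m + i) l) (hs : Joins StripAdj (3 + i) y s)
    (h3 : ∀ a ∈ s, 3 ≤ a) : Joins StripAdj x (6 * m + y) (l ++ s.map (6 * m + ·)) := by
  refine h.append (hs.shift m h3) ?_
  convert stripAdj_add_three (6 * m + i) using 1
  ring

theorem six_mul_succ_add (m i : ℕ) : 6 * (m + 1) + i = 6 * m + (6 + i) := by ring

theorem exists_mem_block {m x : ℕ} (h : 6 * m + 3 ≤ x) (h' : x < 6 * (m + 1) + 3) :
    ∃ v ∈ block, x = 6 * m + v :=
  ⟨x - 6 * m, by simp; omega, by omega⟩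

theorem SpanningPaths.split_mixed {m x y : ℕ} (hm : SpanningPaths m) (hx : x < 6 * m + 3)
    (hy : 6 * m + 3 ≤ y) (hy' : y < 6 * (m + 1) + 3) : ∃ i j : Fin 3, i ≠ j ∧ ∃ l₁ l₂,
    Joins StripAdj x (6 * (m + 1) + i) l₁ ∧ Joins StripAdj y (6 * (m + 1) + j) l₂ ∧
      (l₁ ++ l₂).Perm (List.range (6 * (m + 1) + 3)) := by
  obtain ⟨v, hv, rfl⟩ := exists_mem_block hy hy'
  obtain ⟨e, he⟩ := exists_blockSplit_mixed v hv
  obtain ⟨i, hi, l, hl, hlp⟩ := hm.reach x hx e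
  obtain ⟨i', j', hij, t, -, h₁, h₂, hp⟩ := he i hi
  have h3 := three_le_of_append_perm_block hp
  refine ⟨i', j', hij, l ++ t.1.map (6 * m + ·), t.2.map (6 * m + ·), ?_, ?_,
    perm_range_of_perm_block hlp hp ?_⟩
  · rw [six_mul_succ_add]
    exact hl.append_block h₁ h3.1
  · rw [six_mul_succ_add]
    exact h₂.shift m h3.2
  · simp

theorem SpanningPaths.succ {m : ℕ} (hm : SpanningPaths m) : SpanningPaths (m + 1) where
  through i j hij := by
    obtain ⟨t, -, ht⟩ := exists_through_detour i j hij
    obtain ⟨l, hl, hp⟩ := hm.exists_of_detour ht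
    rw [← six_mul_succ_add, ← six_mul_succ_add] at hl
    exact ⟨l, hl, by simpa using hp⟩
  reach x hx e := by
    by_cases hxm : x < 6 * m + 3
    · obtain ⟨i, hi, l, hl, hlp⟩ := hm.reach x hxm e
      obtain ⟨s, -, hs, hp⟩ := exists_blockPath i
      have hls := hl.append_block hs (three_le_of_append_perm_block (t := []) (by simpa)).1
      rw [← six_mul_succ_add] at hls
      exact ⟨i, hi, _, hls, perm_range_of_perm_block hlp hp (.refl _)⟩
    · obtain ⟨v, hv, rfl⟩ := exists_mem_block (not_lt.1 hxm) hx
      obtain ⟨i, hi, t, -, ht⟩ := exists_reach_detour v hv e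
      obtain ⟨l, hl, hp⟩ := hm.exists_of_detour ht
      rw [← six_mul_succ_add] at hl
      exact ⟨i, hi, l, hl, by simpa using hp⟩
  split x hx y hy hxy := by
    wlog hlt : x < y generalizing x y
    · obtain ⟨i, j, hij, l₁, l₂, h₁, h₂, hp⟩ := this y hy x hx hxy.symm (by omega)
      exact ⟨j, i, hij.symm, l₂, l₁, h₂, h₁, List.perm_append_comm.trans hp⟩
    by_cases hxm : x < 6 * m + 3
    · by_cases hym : y < 6 * m + 3
      · obtain ⟨i, j, hij, l₁, l₂, hl₁, hl₂, hlp⟩ := hm.split x hxm y hym hxy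
        obtain ⟨i', j', hij', t, -, h₁, h₂, hp⟩ := exists_blockSplit_left i j hij
        have h3 := three_le_of_append_perm_block hp
        have h₁' := hl₁.append_block h₁ h3.1
        have h₂' := hl₂.append_block h₂ h3.2
        rw [← six_mul_succ_add] at h₁' h₂'
        refine ⟨i', j', hij', _, _, h₁', h₂', perm_range_of_perm_block hlp hp ?_⟩
        rw [List.perm_iff_count]
        intro a
        simp only [List.count_append, List.map_append]
        ring
      · exact hm.split_mixed hxm (not_lt.1 hym) hy
    · obtain ⟨v, hv, rfl⟩ := exists_mem_block (not_lt.1 hxm) hx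
      obtain ⟨w, hw, rfl⟩ := exists_mem_block (m := m) (by omega) hy
      obtain ⟨i, j, hij, t, -, ht, hs⟩ := exists_split_detour v hv w hw (by omega)
      obtain ⟨l, hl, hp⟩ := hm.exists_of_detour ht
      have hs' := hs.shift m (three_le_of_append_perm_block ht.1).2
      rw [← six_mul_succ_add] at hl hs'
      exact ⟨i, j, hij, l, _, hl, hs', hp⟩

theorem spanningPaths : ∀ m, SpanningPaths m
  | 0 => spanningPaths_zero
  | m + 1 => (spanningPaths m).succ

/-- Adjacency in the strip up to the vertex `n`, which is joined to the three vertices before it. -/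
def ClosedStripAdj (n a b : ℕ) : Prop :=
  StripAdj a b ∨ (b = n ∧ b ≤ a + 3 ∧ a < b) ∨ (a = n ∧ a ≤ b + 3 ∧ b < a)

theorem ClosedStripAdj.symm {n a b : ℕ} (h : ClosedStripAdj n a b) : ClosedStripAdj n b a :=
  h.imp StripAdj.symm Or.symm

theorem exists_closedStrip_neighbors {n v : ℕ} (hn : n % 6 = 3) (hn' : 9 ≤ n) (hv : v ≤ n) :
    ∃ x y z : ℕ, x < y ∧ y < z ∧ z ≤ n ∧
      (∀ w, w = x ∨ w = y ∨ w = z → ClosedStripAdj n v w) ∧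
      ∀ w ≤ n, ClosedStripAdj n v w → w = x ∨ w = y ∨ w = z := by
  obtain ⟨z, hz⟩ : ∃ z, z = v + 3 ∧ v + 3 < n ∨ z = n ∧ n ≤ v + 3 := by
    by_cases hv' : v + 3 < n
    exacts [⟨_, .inl ⟨rfl, hv'⟩⟩, ⟨_, .inr ⟨rfl, not_lt.1 hv'⟩⟩]
  obtain hc | hc | hc | hc | hc | hc | hc | hc | hc | hc : v = n ∨ v = 0 ∨ v = 1 ∨ v = 2 ∨
    (3 ≤ v ∧ v < n ∧ v % 6 = 0) ∨ (3 ≤ v ∧ v < n ∧ v % 6 = 1) ∨ (3 ≤ v ∧ v < n ∧ v % 6 = 2) ∨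
    (3 ≤ v ∧ v < n ∧ v % 6 = 3) ∨ (3 ≤ v ∧ v < n ∧ v % 6 = 4) ∨
    (3 ≤ v ∧ v < n ∧ v % 6 = 5) := by omega
  on_goal 1 => refine ⟨v - 3, v - 2, v - 1, ?_⟩
  on_goal 2 => refine ⟨1, 2, 3, ?_⟩
  on_goal 3 => refine ⟨0, 2, 4, ?_⟩
  on_goal 4 => refine ⟨0, 1, 5, ?_⟩
  on_goal 5 => refine ⟨v - 3, v - 2, z, ?_⟩
  on_goal 6 => refine ⟨v - 3, v + 1, z, ?_⟩
  on_goal 7 => refine ⟨v - 3, v - 1, z, ?_⟩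
  on_goal 8 => refine ⟨v - 3, v + 2, z, ?_⟩
  on_goal 9 => refine ⟨v - 3, v + 2, z, ?_⟩
  on_goal 10 => refine ⟨v - 3, v - 2, z, ?_⟩
  all_goals
    refine ⟨by omega, by omega, by omega, fun w hw => ?_, fun w hwn hw => ?_⟩
    · unfold ClosedStripAdj StripAdj StripEdge
      simp only [or_assoc]
      rcases hw with hw | hw | hw <;> rcases hz with hz | hz <;>
        repeat' first
          | (refine Or.inl ?_; omega)
          | refine Or.inr ?_
          | omega
    · unfold ClosedStripAdj StripAdj StripEdge at hw
      rcases hw with ((hw | hw | hw | hw | hw) | hw | hw | hw | hw | hw) | hw | hw <;> omega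

/-- The strip with `k + 2` blocks, closed by one vertex joined to its three last vertices. -/
def closedStrip (k : ℕ) : SimpleGraph (Fin (16 + 6 * k)) where
  Adj u v := ClosedStripAdj (15 + 6 * k) u v
  symm := ⟨fun _ _ h => h.symm⟩
  loopless := ⟨fun u h => by
    simp only [ClosedStripAdj, StripAdj, StripEdge] at h
    omega⟩

theorem closedStrip_adj {k : ℕ} {u v : Fin (16 + 6 * k)} :
    (closedStrip k).Adj u v ↔ ClosedStripAdj (15 + 6 * k) u v :=
  Iff.rfl

theorem ncard_neighborSet_closedStrip {k : ℕ} (v : Fin (16 + 6 * k)) :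
    ((closedStrip k).neighborSet v).ncard = 3 := by
  obtain ⟨x, y, z, hxy, hyz, hz, h₁, h₂⟩ :=
    exists_closedStrip_neighbors (n := 15 + 6 * k) (v := v) (by omega) (by omega) (by omega)
  rw [Set.ncard_eq_three]
  refine ⟨⟨x, by omega⟩, ⟨y, by omega⟩, ⟨z, by omega⟩, by simp; omega, by simp; omega,
    by simp; omega, Set.ext fun w => ?_⟩
  simpa [closedStrip_adj, Fin.ext_iff] using (⟨h₂ w (by omega), h₁ w⟩ : _ ↔ _)

/-- A walk given by a duplicate-free list of all vertices is a hamiltonian path. -/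
theorem Joins.exists_isPath {V : Type*} {G : SimpleGraph V} {u v : V} {l : List V}
    (h : Joins G.Adj u v l) (hl : l.Nodup) (hmem : ∀ w, w ∈ l) :
    ∃ p : G.Walk u v, p.IsPath ∧ ∀ w : V, w ∈ p.support := by
  obtain ⟨hc, hu, hv⟩ := h
  have hne : l ≠ [] := by rintro rfl; simp at hu
  have hu' : l.head hne = u := by simpa [List.head?_eq_some_head hne] using hu
  have hv' : l.getLast hne = v := by simpa [List.getLast?_eq_some_getLast hne] using hv
  refine ⟨(SimpleGraph.Walk.ofSupport l hne hc).copy hu' hv', ?_, ?_⟩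
  · simpa [SimpleGraph.Walk.isPath_def] using hl
  · simpa using hmem

theorem exists_spanning_joins (m : ℕ) {x y : ℕ} (hx : x ≤ 6 * m + 3) (hy : y ≤ 6 * m + 3)
    (hxy : x ≠ y) : ∃ l, Joins (ClosedStripAdj (6 * m + 3)) x y l ∧
      l.Perm (List.range (6 * m + 4)) := by
  have hsymm : ∀ a b, ClosedStripAdj (6 * m + 3) a b → ClosedStripAdj (6 * m + 3) b a :=
    fun _ _ => .symm
  wlog hlt : x < y generalizing x y
  · obtain ⟨l, hl, hp⟩ := this hy hx hxy.symm (by omega)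
    exact ⟨l.reverse, hl.reverse hsymm, l.reverse_perm.trans hp⟩
  have hm := spanningPaths m
  have hlast : ∀ i : Fin 3, ClosedStripAdj (6 * m + 3) (6 * m + i) (6 * m + 3) := fun i =>
    Or.inr (Or.inl ⟨rfl, by omega, by omega⟩)
  have hmono : ∀ {x y l}, Joins StripAdj x y l → Joins (ClosedStripAdj (6 * m + 3)) x y l :=
    fun h => h.mono fun _ _ => Or.inl
  have hrange : List.range (6 * m + 4) = List.range (6 * m + 3) ++ [6 * m + 3] :=
    List.range_succ
  rw [hrange]
  obtain hy | rfl := hy.lt_or_eq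
  · obtain ⟨i, j, -, l₁, l₂, h₁, h₂, hp⟩ := hm.split x (by omega) y hy hxy
    refine ⟨l₁ ++ [6 * m + 3] ++ l₂.reverse, ((hmono h₁).append (.singleton _) (hlast i)).append
      ((hmono h₂).reverse hsymm) (hsymm _ _ (hlast j)), ?_⟩
    rw [List.perm_iff_count] at hp ⊢
    intro a
    have := hp a
    simp only [List.count_append, List.count_reverse] at this ⊢
    omega
  · obtain ⟨i, -, l, h, hp⟩ := hm.reach x hlt 0
    exact ⟨l ++ [6 * m + 3], (hmono h).append (.singleton _) (hlast i), hp.append_right _⟩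

theorem hamiltonianConnected_closedStrip (k : ℕ) : (closedStrip k).HamiltonianConnected := by
  intro u v huv
  obtain ⟨l, ⟨hc, hu, hv⟩, hp⟩ := exists_spanning_joins (k + 2) (x := u) (y := v) (by omega)
    (by omega) (by omega)
  have hmem : ∀ a, a ∈ l ↔ a < 16 + 6 * k := fun a => by
    rw [hp.mem_iff, List.mem_range]
    omega
  lift l to List (Fin (16 + 6 * k)) using fun a ha => (hmem a).1 ha
  refine Joins.exists_isPath (l := l) ⟨?_, ?_, ?_⟩ ?_ fun w => ?_
  · rw [List.isChain_map] at hc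
    refine hc.imp fun a b h => ?_
    rw [show 6 * (k + 2) + 3 = 15 + 6 * k by ring] at h
    exact h
  · simpa [Fin.val_inj] using hu
  · simpa [Fin.val_inj] using hv
  · exact List.Nodup.of_map _ (hp.nodup_iff.2 List.nodup_range)
  · simpa [Fin.val_inj] using (hmem w).2 w.2

theorem val_le_val_add_length {k : ℕ} {u v : Fin (16 + 6 * k)} (p : (closedStrip k).Walk u v) :
    (v : ℕ) ≤ u + 3 * p.length := by
  induction p with
  | nil => simp
  | cons h p ih =>
    simp only [closedStrip_adj, ClosedStripAdj, StripAdj, StripEdge] at h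
    rw [SimpleGraph.Walk.length_cons]
    omega

/-- Without its first and last vertex the closed strip is bipartite, with colour classes given
by `n ↦ (n + 1) % 6 / 3`. -/
theorem even_length_add_color {k : ℕ} {u v : Fin (16 + 6 * k)} (p : (closedStrip k).Walk u v)
    (hp : ∀ w ∈ p.support, (w : ℕ) ≠ 0 ∧ (w : ℕ) ≠ 15 + 6 * k) :
    Even (p.length + ((u : ℕ) + 1) % 6 / 3 + ((v : ℕ) + 1) % 6 / 3) := by
  induction p with
  | nil => simp [← two_mul]
  | @cons a b c h p ih =>
    have ih := ih fun w hw => hp w (by simp [hw])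
    have ha := hp a (by simp)
    have hb := hp b (by simp)
    simp only [closedStrip_adj, ClosedStripAdj, StripAdj, StripEdge] at h
    rw [SimpleGraph.Walk.length_cons]
    rw [Nat.even_iff] at *
    omega

theorem le_length_of_odd_isPath {k : ℕ} {u v : Fin (16 + 6 * k)} (hu : (u : ℕ) = 0)
    (hv : (v : ℕ) = 1) (p : (closedStrip k).Walk u v) (hp : p.IsPath) (hodd : Odd p.length)
    (hlen : 3 ≤ p.length) : 10 + 4 * k ≤ p.length := by
  by_cases hmem : (⟨15 + 6 * k, by omega⟩ : Fin (16 + 6 * k)) ∈ p.support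
  · have h₁ := val_le_val_add_length (p.takeUntil _ hmem)
    have h₂ := val_le_val_add_length (p.dropUntil _ hmem).reverse
    have h := congrArg SimpleGraph.Walk.length (p.take_spec hmem)
    simp only [SimpleGraph.Walk.length_append, SimpleGraph.Walk.length_reverse] at h h₂
    simp only at h₁ h₂
    omega
  · exfalso
    cases p with
    | nil => simp at hlen
    | @cons _ b _ h q =>
      rw [SimpleGraph.Walk.cons_isPath_iff] at hp
      rw [SimpleGraph.Walk.length_cons] at hodd hlen
      have hq := even_length_add_color q fun w hw => by
        constructor
        · intro h0
          exact hp.2 (by rwa [show u = w from Fin.ext (hu.trans h0.symm)])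
        · intro h0
          exact hmem (by
            rw [show (⟨15 + 6 * k, by omega⟩ : Fin (16 + 6 * k)) = w from Fin.ext h0.symm]
            simp [hw])
      have hb : (b : ℕ) ≠ 1 := fun hb => by
        obtain rfl : b = v := Fin.ext (hb.trans hv.symm)
        have := SimpleGraph.Walk.length_eq_zero_iff.2 (SimpleGraph.Walk.isPath_iff_nil.1 hp.1)
        omega
      simp only [closedStrip_adj, ClosedStripAdj, StripAdj, StripEdge] at h
      rw [Nat.even_iff] at hq
      rw [Nat.odd_iff] at hodd
      omega

/-- For every `k` there is a cubic hamiltonian-connected graph on `16 + 6k` vertices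
with two adjacent vertices having no path of any odd length `ℓ` with `3 ≤ ℓ ≤ 9 + 4k`
between them. -/
theorem exists_cubic_hamConnected_missing_odd_path_lengths (k : ℕ) :
    ∃ G : SimpleGraph (Fin (16 + 6 * k)),
      (∀ v, (G.neighborSet v).ncard = 3) ∧
      G.HamiltonianConnected ∧
      ∃ u v, G.Adj u v ∧
        ∀ p : G.Walk u v, p.IsPath →
          ¬ (Odd p.length ∧ 3 ≤ p.length ∧ p.length ≤ 9 + 4 * k) := by
  refine ⟨closedStrip k, ncard_neighborSet_closedStrip, hamiltonianConnected_closedStrip k,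
    ⟨0, by omega⟩, ⟨1, by omega⟩, ?_, fun p hp ⟨hodd, hlen, hle⟩ => ?_⟩
  · simp [closedStrip_adj, ClosedStripAdj, StripAdj, StripEdge]
  · have := le_length_of_odd_isPath rfl rfl p hp hodd hlen
    omega
end
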